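/- Essentially uniform σ-simple approximation of essentially separable functions: Let (Ω, ℱ, μ) be a finite measure space, let V be a uniform space equipped with its Borel σ-algebra, and let u : Ω → V be Borel measurable and μ-essentially separably valued. Let Λ be a directed index set for a fundamental system of entourages {U_λ}_{λ∈Λ} of V (so that the sets N_λ[v] := {v' ∈ V : (v, v') ∈ U_λ} form a neighbourhood basis at each point v ∈ V). Then there exist a set Z ∈ ℱ with μ(Z) = 0 and a net (φ_λ)_{λ∈Λ} of measurable σ-simple functions φ_λ : Ω → V such that φ_λ → u uniformly on Ω ∖ Z, in the sense that for every entourage U there is λ_0 ∈ Λ such that for all λ ≥ λ_0 and all ω ∈ Ω ∖ Z, (u(ω), φ_λ(ω)) ∈ U. -/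

import Mathlib

open MeasureTheory Filter Topology Set

/-- A σ-simple function: countably many values, each fibre measurable. -/
def IsSigmaSimpleFunc {Ω V : Type*} [MeasurableSpace Ω] (φ : Ω → V) : Prop :=
  (Set.range φ).Countable ∧ ∀ v : V, MeasurableSet (φ ⁻¹' {v})

/-- A function with values almost everywhere in the closure of the range of a sequence can be
approximated up to any entourage, off the exceptional set, by a σ-simple function. -/
theorem exists_isSigmaSimpleFunc_of_mem_uniformity
    {Ω V : Type*} [MeasurableSpace Ω] [UniformSpace V] {u : Ω → V}
    (hBorel : ∀ A : Set V, IsOpen A → MeasurableSet (u ⁻¹' A))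
    {Z : Set Ω} (hZ : MeasurableSet Z) {c : ℕ → V} (hc : u '' Zᶜ ⊆ closure (range c))
    {s : Set (V × V)} (hs : s ∈ uniformity V) :
    ∃ φ : Ω → V, IsSigmaSimpleFunc φ ∧ ∀ ω ∉ Z, (u ω, φ ω) ∈ s := by
  classical
  obtain ⟨W, ⟨hW, hWo⟩, hWs⟩ := uniformity_hasBasis_open.mem_iff.1 hs
  have hex : ∀ ω, ∃ n, (u ω, c n) ∈ W ∨ ω ∈ Z := by
    intro ω
    by_cases hω : ω ∈ Z
    · exact ⟨0, Or.inr hω⟩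
    · obtain ⟨_, hv, n, rfl⟩ := mem_closure_iff_nhds.1 (hc (mem_image_of_mem u hω)) _
        (mem_nhds_left (u ω) hW)
      exact ⟨n, Or.inl hv⟩
  have hmeas : ∀ n, MeasurableSet {ω | (u ω, c n) ∈ W ∨ ω ∈ Z} := fun n =>
    (hBorel {v | (v, c n) ∈ W} (hWo.preimage (by fun_prop))).union hZ
  have hfind : Measurable fun ω => Nat.find (hex ω) := measurable_find hex hmeas
  refine ⟨fun ω => c (Nat.find (hex ω)), ⟨?_, fun v => ?_⟩, fun ω hω => ?_⟩
  · exact (countable_range c).mono (range_comp_subset_range _ c)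
  · exact hfind (MeasurableSet.of_discrete (s := c ⁻¹' {v}))
  · exact hWs ((Nat.find_spec (hex ω)).resolve_right hω)

/-- **Essentially uniform σ-simple approximation of essentially separable functions.**
Let `u : Ω → V` be a Borel measurable, `μ`-essentially separably valued function from a finite
measure space into a uniform space `V`, and let `(U l)_{l ∈ Λ}` be a fundamental system of
entourages of `V` indexed by a directed set `Λ`.  Then there are a `μ`-null measurable set `Z`
and a net `(φ l)_{l ∈ Λ}` of measurable σ-simple functions converging to `u` uniformly on
`Ω \ Z`. -/
theorem ess_unif_sigma_simple_approx_of_ess_sep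
    {Ω V : Type*} [MeasurableSpace Ω] [UniformSpace V]
    (μ : Measure Ω) [IsFiniteMeasure μ]
    (u : Ω → V)
    (hBorel : ∀ A : Set V, IsOpen A → MeasurableSet (u ⁻¹' A))
    (hsep : ∃ Z : Set Ω, MeasurableSet Z ∧ μ Z = 0 ∧
      ∃ C : Set V, C.Countable ∧ u '' Zᶜ ⊆ closure C)
    (Λ : Type*) [Preorder Λ] [IsDirected Λ (· ≤ ·)] [Nonempty Λ]
    (U : Λ → Set (V × V)) (hU : (uniformity V).HasBasis (fun _ : Λ => True) U)
    (hUanti : Antitone U) :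
    ∃ Z : Set Ω, MeasurableSet Z ∧ μ Z = 0 ∧
      ∃ φ : Λ → Ω → V, (∀ l, IsSigmaSimpleFunc (φ l)) ∧
        ∀ s ∈ uniformity V, ∃ l₀ : Λ, ∀ l ≥ l₀, ∀ ω ∉ Z, (u ω, φ l ω) ∈ s := by
  obtain ⟨Z, hZ, hμZ, C, hC, hCu⟩ := hsep
  refine ⟨Z, hZ, hμZ, ?_⟩
  have happrox : ∀ l, ∃ φ : Ω → V, IsSigmaSimpleFunc φ ∧ ∀ ω ∉ Z, (u ω, φ ω) ∈ U l := by
    intro l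
    rcases isEmpty_or_nonempty Ω with hΩ | ⟨⟨ω₀⟩⟩
    · exact ⟨u, ⟨by simp [range_eq_empty], fun v => by simp [Set.eq_empty_of_isEmpty]⟩,
        fun ω => hΩ.elim ω⟩
    · obtain ⟨c, hc⟩ := (hC.insert (u ω₀)).exists_eq_range (insert_nonempty _ _)
      exact exists_isSigmaSimpleFunc_of_mem_uniformity hBorel hZ
        (hCu.trans (closure_mono (hc ▸ subset_insert _ _))) (hU.mem_of_mem trivial)
  choose φ hφ hφU using happrox
  refine ⟨φ, hφ, fun s hs => ?_⟩
  obtain ⟨l₀, -, hl₀⟩ := hU.mem_iff.1 hs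
  exact ⟨l₀, fun l hl ω hω => hl₀ (hUanti hl (hφU l ω hω))⟩
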